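/- Let P be a partially ordered set, X a string over P, and q ∈ P an atom. If X ⇒ q^(0) in the free pregroup on P, then X ⇒ q^(0) is derivable using only (CON) and (IND) steps, i.e. without any (EXP) steps. -/

import Mathlib

/-! Free pregroup rewriting over a partially ordered set `P`.
A term is a pair `(p, n) : P × ℤ` representing `p^(n)`; a string is a list of terms. -/

/-- (CON): `X, p^(n), p^(n+1), Y → X, Y`. -/
inductive ConStep {P : Type*} [PartialOrder P] : List (P × ℤ) → List (P × ℤ) → Prop
  | con (X Y : List (P × ℤ)) (p : P) (n : ℤ) :
      ConStep (X ++ [(p, n), (p, n + 1)] ++ Y) (X ++ Y)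

/-- (EXP): `X, Y → X, p^(n+1), p^(n), Y`. -/
inductive ExpStep {P : Type*} [PartialOrder P] : List (P × ℤ) → List (P × ℤ) → Prop
  | exp (X Y : List (P × ℤ)) (p : P) (n : ℤ) :
      ExpStep (X ++ Y) (X ++ [(p, n + 1), (p, n)] ++ Y)

/-- (IND): `X, p^(n), Y → X, q^(n), Y` whenever `p ≤ q` and `n` even, or `q ≤ p` and `n` odd. -/
inductive IndStep {P : Type*} [PartialOrder P] : List (P × ℤ) → List (P × ℤ) → Prop
  | ind (X Y : List (P × ℤ)) (p q : P) (n : ℤ)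
      (h : (p ≤ q ∧ Even n) ∨ (q ≤ p ∧ Odd n)) :
      IndStep (X ++ [(p, n)] ++ Y) (X ++ [(q, n)] ++ Y)

/-- A rewriting step of the free pregroup: (CON), (EXP) or (IND). -/
def Step {P : Type*} [PartialOrder P] (a b : List (P × ℤ)) : Prop :=
  ConStep a b ∨ ExpStep a b ∨ IndStep a b

/-- The order on terms: `p^(n) ≤ q^(n)` in the free pregroup on `P`. -/
def TermLE {P : Type*} [PartialOrder P] (n : ℤ) (p q : P) : Prop :=
  (p ≤ q ∧ Even n) ∨ (q ≤ p ∧ Odd n)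

theorem TermLE.refl {P : Type*} [PartialOrder P] (n : ℤ) (p : P) : TermLE n p p :=
  (Int.even_or_odd n).imp (⟨le_rfl, ·⟩) (⟨le_rfl, ·⟩)

theorem TermLE.trans {P : Type*} [PartialOrder P] {n : ℤ} {p q r : P}
    (h₁ : TermLE n p q) (h₂ : TermLE n q r) : TermLE n p r := by
  rcases h₁ with ⟨h₁, e₁⟩ | ⟨h₁, e₁⟩ <;> rcases h₂ with ⟨h₂, e₂⟩ | ⟨h₂, e₂⟩
  · exact Or.inl ⟨h₁.trans h₂, e₁⟩
  · exact absurd e₁ (Int.not_even_iff_odd.2 e₂)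
  · exact absurd e₂ (Int.not_even_iff_odd.2 e₁)
  · exact Or.inr ⟨h₂.trans h₁, e₁⟩

theorem termLE_add_one {P : Type*} [PartialOrder P] {n : ℤ} {p q : P} :
    TermLE (n + 1) p q ↔ TermLE n q p := by
  simp only [TermLE, ← Int.not_even_iff_odd, Int.even_add_one]
  tauto

/-- A rewriting step that is not an expansion. -/
def ReductionStep {P : Type*} [PartialOrder P] (a b : List (P × ℤ)) : Prop :=
  ConStep a b ∨ IndStep a b

theorem ReductionStep.con {P : Type*} [PartialOrder P] (X Y : List (P × ℤ)) (p : P) (n : ℤ) :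
    ReductionStep (X ++ (p, n) :: (p, n + 1) :: Y) (X ++ Y) := by
  simpa [ReductionStep] using Or.inl (ConStep.con X Y p n)

theorem ReductionStep.ind {P : Type*} [PartialOrder P] (X Y : List (P × ℤ)) {p q : P} {n : ℤ}
    (h : TermLE n p q) : ReductionStep (X ++ (p, n) :: Y) (X ++ (q, n) :: Y) := by
  simpa [ReductionStep] using Or.inr (IndStep.ind X Y p q n h)

/-- One reduction step out of `X, a^(n+1), b^(n), Y`, where `a^(n) ≤ b^(n)`, either keeps such an
expanded pair or is matched by a step out of `X, Y`. -/
theorem ReductionStep.of_expansion {P : Type*} [PartialOrder P] {X Y Z : List (P × ℤ)} {a b : P}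
    {n : ℤ} (hab : TermLE n a b)
    (h : ReductionStep (X ++ (a, n + 1) :: (b, n) :: Y) Z) :
    ReductionStep (X ++ Y) Z ∨ ∃ X' Y' a' b', TermLE n a' b' ∧
      Z = X' ++ (a', n + 1) :: (b', n) :: Y' ∧
      Relation.ReflTransGen ReductionStep (X ++ Y) (X' ++ Y') := by
  generalize hW : X ++ (a, n + 1) :: (b, n) :: Y = W at h
  rcases h with ⟨U, V, p, m⟩ | ⟨U, V, p, q, m, hpq⟩
  · rw [List.append_assoc, List.append_eq_append_iff] at hW
    rcases hW with ⟨S, rfl, hS⟩ | ⟨S, rfl, hS⟩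
    · rcases S with _ | ⟨s, _ | ⟨t, S⟩⟩
      · simp at hS
        omega
      · simp at hS
        obtain ⟨rfl, ⟨rfl, rfl⟩, rfl⟩ := hS
        left
        simpa using ReductionStep.ind X V (termLE_add_one.2 hab)
      · simp at hS
        obtain ⟨rfl, rfl, rfl⟩ := hS
        refine Or.inr ⟨X, S ++ V, a, b, hab, by simp, .single ?_⟩
        simpa using ReductionStep.con (X ++ S) V p m
    · rcases S with _ | ⟨s, _ | ⟨t, S⟩⟩
      · simp at hS
        omega
      · simp at hS
        obtain ⟨rfl, ⟨rfl, rfl⟩, rfl⟩ := hS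
        left
        simpa using ReductionStep.ind U Y hab
      · simp at hS
        obtain ⟨rfl, rfl, rfl⟩ := hS
        refine Or.inr ⟨U ++ S, Y, a, b, hab, by simp, .single ?_⟩
        simpa using ReductionStep.con U (S ++ Y) p m
  · right
    rw [List.append_assoc, List.append_eq_append_iff] at hW
    rcases hW with ⟨S, rfl, hS⟩ | ⟨S, rfl, hS⟩
    · rcases S with _ | ⟨s, _ | ⟨t, S⟩⟩
      · simp at hS
        obtain ⟨⟨rfl, rfl⟩, rfl⟩ := hS
        exact ⟨X, Y, q, b, (termLE_add_one.1 hpq).trans hab, by simp, .refl⟩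
      · simp at hS
        obtain ⟨rfl, ⟨rfl, rfl⟩, rfl⟩ := hS
        exact ⟨X, Y, a, q, hab.trans hpq, by simp, .refl⟩
      · simp at hS
        obtain ⟨rfl, rfl, rfl⟩ := hS
        refine ⟨X, S ++ (q, m) :: V, a, b, hab, by simp, .single ?_⟩
        simpa using ReductionStep.ind (X ++ S) V hpq
    · rcases S with _ | ⟨s, S⟩
      · simp at hS
        obtain ⟨⟨rfl, rfl⟩, rfl⟩ := hS
        exact ⟨U, Y, q, b, (termLE_add_one.1 hpq).trans hab, by simp, by simpa using .refl⟩
      · simp at hS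
        obtain ⟨rfl, rfl⟩ := hS
        refine ⟨U ++ (q, m) :: S, Y, a, b, hab, by simp, .single ?_⟩
        simpa using ReductionStep.ind U (S ++ Y) hpq

/-- An expansion preceding a reduction to a single term can be eliminated. -/
theorem reduces_of_expansion_reduces {P : Type*} [PartialOrder P] {X Y : List (P × ℤ)} {a b : P}
    {n : ℤ} {t : P × ℤ} (hab : TermLE n a b)
    (h : Relation.ReflTransGen ReductionStep (X ++ (a, n + 1) :: (b, n) :: Y) [t]) :
    Relation.ReflTransGen ReductionStep (X ++ Y) [t] := by
  generalize hW : X ++ (a, n + 1) :: (b, n) :: Y = W at h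
  induction h using Relation.ReflTransGen.head_induction_on generalizing X Y a b with
  | refl =>
    have := congrArg List.length hW
    simp at this
    omega
  | head hstep hrest ih =>
    subst hW
    rcases hstep.of_expansion hab with h | ⟨X', Y', a', b', hab', hZ, h⟩
    · exact .head h hrest
    · exact h.trans (ih hab' hZ.symm)

/-- If `X ⇒ q^(0)` for an atom `q` in the free pregroup on `P`, then the derivation
can be carried out using only (CON) and (IND) steps, i.e. without any (EXP) steps. -/
theorem derivation_to_atom_without_expansions {P : Type*} [PartialOrder P]
    (X : List (P × ℤ)) (q : P)
    (h : Relation.ReflTransGen Step X [(q, (0 : ℤ))]) :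
    Relation.ReflTransGen (fun a b => ConStep a b ∨ IndStep a b) X [(q, (0 : ℤ))] := by
  change Relation.ReflTransGen ReductionStep X [(q, (0 : ℤ))]
  induction h using Relation.ReflTransGen.head_induction_on with
  | refl => exact .refl
  | head hstep _ ih =>
    rcases hstep with h | ⟨X, Y, p, n⟩ | h
    · exact .head (Or.inl h) ih
    · exact reduces_of_expansion_reduces (TermLE.refl n p) (by simpa using ih)
    · exact .head (Or.inr h) ih
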